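/- For every integer k ≥ 0, the set of P-positions of the game W'_k is identical to the set of P-positions of the game W_k, namely {(i,i) : 0 ≤ i < k} ∪ {(A_n + k, B_n + k) : n ≥ 0} ∪ {(B_n + k, A_n + k) : n ≥ 0}. -/

import Mathlib

noncomputable def phi : ℝ := (1 + Real.sqrt 5) / 2
noncomputable def wA (n : ℕ) : ℕ := ⌊phi * n⌋₊
noncomputable def wB (n : ℕ) : ℕ := ⌊phi ^ 2 * n⌋₊

/-- A legal move in the game `W_k` from `p` to `q`: a Nim move, or a diagonal move
whose resulting smaller entry is at least `k`. -/
def WkMove (k : ℕ) (p q : ℕ × ℕ) : Prop :=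
  (∃ t, 1 ≤ t ∧ t ≤ p.1 ∧ q = (p.1 - t, p.2)) ∨
  (∃ t, 1 ≤ t ∧ t ≤ p.2 ∧ q = (p.1, p.2 - t)) ∨
  (∃ s, 1 ≤ s ∧ s ≤ min p.1 p.2 ∧ k ≤ min (p.1 - s) (p.2 - s) ∧ q = (p.1 - s, p.2 - s))

/-- `S` is the set of P-positions of the game with move relation `move`. -/
def IsPPositions (move : ℕ × ℕ → ℕ × ℕ → Prop) (S : Set (ℕ × ℕ)) : Prop :=
  (∀ p ∈ S, ∀ q ∈ S, ¬ move p q) ∧ (∀ p ∉ S, ∃ q ∈ S, move p q)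

/-- `G` is the Sprague–Grundy function of the game with move relation `move`:
at every position, `G` takes the mex of the values of the options. -/
def IsGrundy (move : ℕ × ℕ → ℕ × ℕ → Prop) (G : ℕ × ℕ → ℕ) : Prop :=
  ∀ p, (∀ q, move p q → G q ≠ G p) ∧ (∀ v, v < G p → ∃ q, move p q ∧ G q = v)

/-- A legal move in the game `W'_k` from `p` to `q`: a Nim move, or a diagonal move
provided the resulting position is not of the form `(i, i)` with `i < k`. -/
def W'kMove (k : ℕ) (p q : ℕ × ℕ) : Prop :=
  (∃ t, 1 ≤ t ∧ t ≤ p.1 ∧ q = (p.1 - t, p.2)) ∨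
  (∃ t, 1 ≤ t ∧ t ≤ p.2 ∧ q = (p.1, p.2 - t)) ∨
  (∃ s, 1 ≤ s ∧ s ≤ min p.1 p.2 ∧ (¬ ∃ i, i < k ∧ (p.1 - s, p.2 - s) = (i, i)) ∧
    q = (p.1 - s, p.2 - s))

theorem phi_pos : 0 < phi := Real.goldenRatio_pos

theorem phi_sq : phi ^ 2 = phi + 1 := Real.goldenRatio_sq

theorem holderConjugate_phi_phi_sq : phi.HolderConjugate (phi ^ 2) := by
  rw [Real.holderConjugate_iff]
  refine ⟨Real.one_lt_goldenRatio, ?_⟩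
  have h := phi_sq
  have hp := phi_pos
  field_simp
  linarith

theorem wB_eq_wA_add (n : ℕ) : wB n = wA n + n := by
  unfold wA wB
  rw [phi_sq, add_mul, one_mul, Nat.floor_add_natCast (by have := phi_pos; positivity)]

@[simp] theorem wA_zero : wA 0 = 0 := by simp [wA]

theorem wA_strictMono : StrictMono wA := by
  refine strictMono_nat_of_lt_succ fun n => ?_
  have hp : 1 < phi := Real.one_lt_goldenRatio
  have hn : 0 ≤ phi * n := by positivity
  rw [← Nat.succ_le_iff, Nat.succ_eq_add_one, wA, wA, ← Nat.floor_add_one hn]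
  refine Nat.floor_le_floor ?_
  push_cast
  linarith

theorem beattySeq_phi (n : ℕ) : beattySeq phi n = wA n := by
  have := phi_pos
  rw [beattySeq, wA, Int.natCast_floor_eq_floor (by positivity), mul_comm]
  simp

theorem beattySeq_phi_sq (n : ℕ) : beattySeq (phi ^ 2) n = wB n := by
  have := phi_pos
  rw [beattySeq, wB, Int.natCast_floor_eq_floor (by positivity), mul_comm]
  simp

theorem beattySeq_phi_symmDiff :
    symmDiff {x | ∃ k > 0, beattySeq phi k = x} {x | ∃ k > 0, beattySeq (phi ^ 2) k = x} =
      {n | 0 < n} :=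
  Irrational.beattySeq_symmDiff_beattySeq_pos holderConjugate_phi_phi_sq
    Real.goldenRatio_irrational

theorem exists_wA_or_wB {m : ℕ} (hm : 0 < m) : ∃ n > 0, wA n = m ∨ wB n = m := by
  have h : (m : ℤ) ∈ {n : ℤ | 0 < n} := by simpa using hm
  rw [← beattySeq_phi_symmDiff, Set.mem_symmDiff] at h
  rcases h with ⟨⟨n, hn, h⟩, -⟩ | ⟨⟨n, hn, h⟩, -⟩ <;> lift n to ℕ using hn.le
  · rw [beattySeq_phi] at h
    exact ⟨n, by omega, Or.inl (by omega)⟩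
  · rw [beattySeq_phi_sq] at h
    exact ⟨n, by omega, Or.inr (by omega)⟩

theorem wA_ne_wB {m n : ℕ} (hm : 0 < m) (hn : 0 < n) : wA m ≠ wB n := by
  intro h
  have hA : (wA m : ℤ) ∈ {x | ∃ k > 0, beattySeq phi k = x} :=
    ⟨m, by omega, beattySeq_phi m⟩
  have hB : (wA m : ℤ) ∈ {x | ∃ k > 0, beattySeq (phi ^ 2) k = x} :=
    ⟨n, by omega, by rw [beattySeq_phi_sq, h]⟩
  have hpos : (wA m : ℤ) ∈ {n : ℤ | 0 < n} := by
    have := wA_strictMono hm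
    rw [wA_zero] at this
    simpa using this
  rw [← beattySeq_phi_symmDiff, Set.mem_symmDiff] at hpos
  tauto

theorem eq_zero_of_wA_eq_wB {m n : ℕ} (h : wA m = wB n) : m = 0 ∧ n = 0 := by
  have hm := wA_strictMono.le_apply (x := m)
  have hn := wA_strictMono.le_apply (x := n)
  have hB := wB_eq_wA_add n
  rcases Nat.eq_zero_or_pos m with rfl | hm'
  · rw [wA_zero] at h
    omega
  · rcases Nat.eq_zero_or_pos n with rfl | hn'
    · rw [wA_zero] at hB
      omega
    · exact absurd h (wA_ne_wB hm' hn')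

/-- The claimed set of P-positions of both `W_k` and `W'_k`. -/
def shiftedWythoff (k : ℕ) : Set (ℕ × ℕ) :=
  {p : ℕ × ℕ | ∃ i, i < k ∧ p = (i, i)} ∪
    {p : ℕ × ℕ | ∃ n, p = (wA n + k, wB n + k)} ∪
    {p : ℕ × ℕ | ∃ n, p = (wB n + k, wA n + k)}

theorem mem_shiftedWythoff {k a b : ℕ} :
    (a, b) ∈ shiftedWythoff k ↔ (a < k ∧ a = b) ∨
      (∃ n, a = wA n + k ∧ b = wB n + k) ∨ (∃ n, a = wB n + k ∧ b = wA n + k) := by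
  simp only [shiftedWythoff, Set.mem_union, Set.mem_ofPred_eq, Prod.mk.injEq, or_assoc]
  refine or_congr ⟨?_, ?_⟩ Iff.rfl
  · rintro ⟨i, hi, rfl, rfl⟩
    exact ⟨hi, rfl⟩
  · rintro ⟨ha, rfl⟩
    exact ⟨a, ha, rfl, rfl⟩

theorem swap_mem_shiftedWythoff {k a b : ℕ} (h : (a, b) ∈ shiftedWythoff k) :
    (b, a) ∈ shiftedWythoff k := by
  rw [mem_shiftedWythoff] at h ⊢
  rcases h with ⟨h, rfl⟩ | ⟨n, h⟩ | ⟨n, h⟩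
  · exact Or.inl ⟨h, rfl⟩
  · exact Or.inr (Or.inr ⟨n, h.symm⟩)
  · exact Or.inr (Or.inl ⟨n, h.symm⟩)

theorem shiftedWythoff_snd_unique {k a b c : ℕ} (hb : (a, b) ∈ shiftedWythoff k)
    (hc : (a, c) ∈ shiftedWythoff k) : b = c := by
  rw [mem_shiftedWythoff] at hb hc
  rcases hb with hb | ⟨m, hm, hm'⟩ | ⟨m, hm, hm'⟩ <;>
    rcases hc with hc | ⟨n, hn, hn'⟩ | ⟨n, hn, hn'⟩ <;> try omega
  · obtain rfl : m = n := wA_strictMono.injective (by omega)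
    omega
  · obtain ⟨rfl, rfl⟩ := eq_zero_of_wA_eq_wB (m := m) (n := n) (by omega)
    omega
  · obtain ⟨rfl, rfl⟩ := eq_zero_of_wA_eq_wB (m := n) (n := m) (by omega)
    omega
  · have hB := wB_eq_wA_add m
    have hB' := wB_eq_wA_add n
    rcases lt_trichotomy m n with h | rfl | h
    · have := wA_strictMono h
      omega
    · omega
    · have := wA_strictMono h
      omega

theorem shiftedWythoff_diagonal {k a b s : ℕ} (h : (a, b) ∈ shiftedWythoff k)
    (ha : s ≤ a) (hb : s ≤ b) (h' : (a - s, b - s) ∈ shiftedWythoff k)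
    (hk : ¬ (a - s < k ∧ a - s = b - s)) : s = 0 := by
  rw [mem_shiftedWythoff] at h h'
  rcases h with h | ⟨m, hm, hm'⟩ | ⟨m, hm, hm'⟩ <;>
    rcases h' with h' | ⟨n, hn, hn'⟩ | ⟨n, hn, hn'⟩ <;> try omega
  all_goals
    have hB := wB_eq_wA_add m
    have hB' := wB_eq_wA_add n
    obtain rfl : m = n := by omega
    omega

theorem WkMove.toW'kMove {k : ℕ} {p q : ℕ × ℕ} (h : WkMove k p q) : W'kMove k p q := by
  rcases h with h | h | ⟨s, h1, h2, h3, rfl⟩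
  · exact Or.inl h
  · exact Or.inr (Or.inl h)
  · refine Or.inr (Or.inr ⟨s, h1, h2, ?_, rfl⟩)
    rintro ⟨i, hi, h⟩
    rw [Prod.mk.injEq] at h
    omega

theorem WkMove.swap {k a b c d : ℕ} (h : WkMove k (a, b) (c, d)) :
    WkMove k (b, a) (d, c) := by
  simp only [WkMove, Prod.mk.injEq] at h ⊢
  rcases h with ⟨t, h⟩ | ⟨t, h⟩ | ⟨s, h⟩
  · exact Or.inr (Or.inl ⟨t, by omega⟩)
  · exact Or.inl ⟨t, by omega⟩
  · exact Or.inr (Or.inr ⟨s, by omega⟩)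

theorem W'kMove.sum_lt {k : ℕ} {p q : ℕ × ℕ} (h : W'kMove k p q) :
    q.1 + q.2 < p.1 + p.2 := by
  rcases h with ⟨t, h1, h2, rfl⟩ | ⟨t, h1, h2, rfl⟩ | ⟨s, h1, h2, -, rfl⟩ <;>
    dsimp only <;> omega

theorem IsPPositions.unique {move : ℕ × ℕ → ℕ × ℕ → Prop}
    (hmove : ∀ p q, move p q → q.1 + q.2 < p.1 + p.2) {S T : Set (ℕ × ℕ)}
    (hS : IsPPositions move S) (hT : IsPPositions move T) : S = T := by
  ext p
  induction hp : p.1 + p.2 using Nat.strong_induction_on generalizing p with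
  | _ N ih =>
    subst hp
    constructor <;> intro h <;> by_contra h'
    · obtain ⟨q, hq, hpq⟩ := hT.2 p h'
      exact hS.1 p h q ((ih _ (hmove p q hpq) q rfl).2 hq) hpq
    · obtain ⟨q, hq, hpq⟩ := hS.2 p h'
      exact hT.1 p h q ((ih _ (hmove p q hpq) q rfl).1 hq) hpq

theorem not_W'kMove_of_mem_shiftedWythoff {k : ℕ} {p q : ℕ × ℕ} (hp : p ∈ shiftedWythoff k)
    (hq : q ∈ shiftedWythoff k) : ¬ W'kMove k p q := by
  obtain ⟨a, b⟩ := p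
  rintro (⟨t, h1, h2, rfl⟩ | ⟨t, h1, h2, rfl⟩ | ⟨s, h1, h2, h3, rfl⟩)
  · have := shiftedWythoff_snd_unique (swap_mem_shiftedWythoff hp) (swap_mem_shiftedWythoff hq)
    dsimp only at h2 this
    omega
  · have := shiftedWythoff_snd_unique hp hq
    dsimp only at h2 this
    omega
  · dsimp only at h2 h3 hq
    have := shiftedWythoff_diagonal hp (by omega) (by omega) hq
      fun h => h3 ⟨a - s, h.1, by rw [← h.2]⟩
    omega

theorem exists_WkMove_of_le {k a b : ℕ} (hab : a ≤ b) (h : (a, b) ∉ shiftedWythoff k) :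
    ∃ c d, (c, d) ∈ shiftedWythoff k ∧ WkMove k (a, b) (c, d) := by
  have nim : ∀ d < b, WkMove k (a, b) (a, d) := fun d hd =>
    Or.inr (Or.inl ⟨b - d, by omega, by omega, by rw [Prod.mk.injEq]; dsimp only; omega⟩)
  simp only [mem_shiftedWythoff] at h ⊢
  push Not at h
  obtain ⟨h1, h2, -⟩ := h
  rcases lt_or_ge a k with hak | hak
  · have := h1 hak
    exact ⟨a, a, Or.inl ⟨hak, rfl⟩, nim a (by omega)⟩
  have cover : ∃ n, wA n + k = a ∨ (0 < n ∧ wB n + k = a) := by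
    rcases Nat.eq_zero_or_pos (a - k) with h0 | hpos
    · exact ⟨0, Or.inl (by rw [wA_zero]; omega)⟩
    · obtain ⟨n, hn, h⟩ := exists_wA_or_wB hpos
      exact ⟨n, by omega⟩
  obtain ⟨n, hn | ⟨hn0, hn⟩⟩ := cover
  · have hne := h2 n hn.symm
    rcases lt_or_gt_of_ne hne with hlt | hgt
    · have hB := wB_eq_wA_add n
      have hB' := wB_eq_wA_add (b - a)
      have hA : wA (b - a) < wA n := wA_strictMono (by omega)
      refine ⟨wA (b - a) + k, wB (b - a) + k, Or.inr (Or.inl ⟨b - a, rfl, rfl⟩),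
        Or.inr (Or.inr ⟨wA n - wA (b - a), by omega, ?_, ?_, ?_⟩)⟩
      · dsimp only; omega
      · dsimp only; omega
      · rw [Prod.mk.injEq]; dsimp only; omega
    · exact ⟨a, wB n + k, Or.inr (Or.inl ⟨n, hn.symm, rfl⟩), nim _ hgt⟩
  · have hB := wB_eq_wA_add n
    exact ⟨a, wA n + k, Or.inr (Or.inr ⟨n, hn.symm, rfl⟩), nim _ (by omega)⟩

theorem exists_WkMove_of_notMem_shiftedWythoff {k : ℕ} {p : ℕ × ℕ}
    (hp : p ∉ shiftedWythoff k) : ∃ q ∈ shiftedWythoff k, WkMove k p q := by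
  obtain ⟨a, b⟩ := p
  rcases le_total a b with hab | hab
  · obtain ⟨c, d, hcd, h⟩ := exists_WkMove_of_le hab hp
    exact ⟨(c, d), hcd, h⟩
  · obtain ⟨c, d, hcd, h⟩ := exists_WkMove_of_le hab fun h => hp (swap_mem_shiftedWythoff h)
    exact ⟨(d, c), swap_mem_shiftedWythoff hcd, h.swap⟩

theorem isPPositions_W'kMove (k : ℕ) : IsPPositions (W'kMove k) (shiftedWythoff k) :=
  ⟨fun _ hp _ hq => not_W'kMove_of_mem_shiftedWythoff hp hq, fun _ hp =>
    let ⟨q, hq, h⟩ := exists_WkMove_of_notMem_shiftedWythoff hp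
    ⟨q, hq, h.toW'kMove⟩⟩

theorem isPPositions_WkMove (k : ℕ) : IsPPositions (WkMove k) (shiftedWythoff k) :=
  ⟨fun _ hp _ hq h => not_W'kMove_of_mem_shiftedWythoff hp hq h.toW'kMove,
    fun _ hp => exists_WkMove_of_notMem_shiftedWythoff hp⟩

theorem W'k_P_positions (k : ℕ) :
    (∀ S : Set (ℕ × ℕ), IsPPositions (W'kMove k) S ↔
      S = {p : ℕ × ℕ | ∃ i, i < k ∧ p = (i, i)} ∪
          {p : ℕ × ℕ | ∃ n, p = (wA n + k, wB n + k)} ∪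
          {p : ℕ × ℕ | ∃ n, p = (wB n + k, wA n + k)}) ∧
    (∀ S : Set (ℕ × ℕ), IsPPositions (WkMove k) S ↔
      S = {p : ℕ × ℕ | ∃ i, i < k ∧ p = (i, i)} ∪
          {p : ℕ × ℕ | ∃ n, p = (wA n + k, wB n + k)} ∪
          {p : ℕ × ℕ | ∃ n, p = (wB n + k, wA n + k)}) := by
  refine ⟨fun S => ⟨fun hS => ?_, ?_⟩, fun S => ⟨fun hS => ?_, ?_⟩⟩
  · exact hS.unique (fun _ _ h => h.sum_lt) (isPPositions_W'kMove k)
  · rintro rfl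
    exact isPPositions_W'kMove k
  · exact hS.unique (fun _ _ h => h.toW'kMove.sum_lt) (isPPositions_WkMove k)
  · rintro rfl
    exact isPPositions_WkMove k
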